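/- arXiv:1908.01661 — 6 statements merged into one kernel-verified Lean document; each statement's English description precedes it below -/
import Mathlib

section
/- Let f : A → B be a homomorphism of algebras of the same algebraic type and let F ⊆ B. Then (1) the preimage congruence f⁻¹[Ω^B F] := {⟨a,a'⟩ ∈ A×A : ⟨f(a),f(a')⟩ ∈ Ω^B F} is contained in Ω^A f⁻¹[F], and (2) if f is surjective then f⁻¹[Ω^B F] = Ω^A f⁻¹[F]. -/
universe u

/-- An algebraic type (signature): a set of function symbols with finite arities. -/
structure AlgSig : Type (u + 1) where
  F : Type u
  ar : F → ℕ

/-- Terms (formulas) over a signature, with a countably infinite set `ℕ` of variables. -/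
inductive Trm (S : AlgSig.{u}) : Type u
  | var : ℕ → Trm S
  | app : (f : S.F) → (Fin (S.ar f) → Trm S) → Trm S

/-- An algebra of a given signature. -/
structure AlgStr (S : AlgSig.{u}) : Type (u + 1) where
  α : Type u
  op : (f : S.F) → (Fin (S.ar f) → α) → α

variable {S : AlgSig.{u}}

/-- Evaluation of a term in an algebra under a valuation (equivalently, the unique
homomorphism from the term algebra determined by the valuation). -/
def Trm.eval (A : AlgStr S) (v : ℕ → A.α) : Trm S → A.α
  | .var n => v n
  | .app f t => A.op f fun i => Trm.eval A v (t i)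

/-- Substitution (an endomorphism of the term algebra). -/
def Trm.subst (σ : ℕ → Trm S) : Trm S → Trm S
  | .var n => σ n
  | .app f t => .app f fun i => Trm.subst σ (t i)

/-- All variables occurring in the term are `< n`. -/
def Trm.varsLT (n : ℕ) : Trm S → Prop
  | .var m => m < n
  | .app _ t => ∀ i, Trm.varsLT n (t i)

/-- The absolutely free term algebra `Fm`. -/
def TrmAlg (S : AlgSig.{u}) : AlgStr S :=
  ⟨Trm S, Trm.app⟩

/-- A congruence of an algebra. -/
def IsCong (A : AlgStr S) (θ : A.α → A.α → Prop) : Prop :=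
  Equivalence θ ∧
    ∀ (f : S.F) (x y : Fin (S.ar f) → A.α), (∀ i, θ (x i) (y i)) → θ (A.op f x) (A.op f y)

/-- A relation is compatible with a subset `F`. -/
def CompatWith {β : Type u} (θ : β → β → Prop) (F : Set β) : Prop :=
  ∀ a b, θ a b → a ∈ F → b ∈ F

/-- The Leibniz congruence `Ω^A F`: the largest congruence of `A` compatible with `F`
(the union of all congruences compatible with `F`). -/
def Leibniz (A : AlgStr S) (F : Set A.α) : A.α → A.α → Prop :=
  fun a b => ∃ θ, IsCong A θ ∧ CompatWith θ F ∧ θ a b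

/-- A matrix `⟨A, F⟩` is reduced if its Leibniz congruence is the identity relation. -/
def IsReducedMatrix (A : AlgStr S) (F : Set A.α) : Prop :=
  ∀ a b, Leibniz A F a b ↔ a = b

/-- A logic: a structural closure operator on sets of formulas. -/
structure Logic (S : AlgSig.{u}) where
  C : Set (Trm S) → Set (Trm S)
  monotone : ∀ ⦃Γ Δ : Set (Trm S)⦄, Γ ⊆ Δ → C Γ ⊆ C Δ
  extensive : ∀ Γ, Γ ⊆ C Γ
  idem : ∀ Γ, C (C Γ) ⊆ C Γ
  structural : ∀ (σ : ℕ → Trm S) (Γ : Set (Trm S)),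
    Trm.subst σ '' C Γ ⊆ C (Trm.subst σ '' Γ)

/-- Deductive filter of a logic over an algebra. -/
def IsDedFilter (Lo : Logic S) (A : AlgStr S) (Fl : Set A.α) : Prop :=
  ∀ (Γ : Set (Trm S)) (φ : Trm S), φ ∈ Lo.C Γ →
    ∀ v : ℕ → A.α, (∀ γ ∈ Γ, Trm.eval A v γ ∈ Fl) → Trm.eval A v φ ∈ Fl

/-- Theories of a logic: the deductive filters over the term algebra. -/
def Theories (Lo : Logic S) : Set (Set (Trm S)) :=
  {Γ | IsDedFilter Lo (TrmAlg S) Γ}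

/-- The deductive filter generated by a set. -/
def FgFilter (Lo : Logic S) (A : AlgStr S) (X : Set A.α) : Set A.α :=
  {a | ∀ G, IsDedFilter Lo A G → X ⊆ G → a ∈ G}

/-- The Suszko congruence of `F` relative to a logic: the intersection of the Leibniz
congruences of all deductive filters extending `F`. -/
def Suszko (Lo : Logic S) (A : AlgStr S) (F : Set A.α) : A.α → A.α → Prop :=
  fun a b => ∀ G, IsDedFilter Lo A G → F ⊆ G → Leibniz A G a b

/-- Unary polynomial functions of an algebra. -/
def IsUnaryPoly (A : AlgStr S) (p : A.α → A.α) : Prop :=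
  ∃ (φ : Trm S) (v : ℕ → A.α), ∀ a, p a = Trm.eval A (Function.update v 0 a) φ

/-- The set of solutions `τ(A)` of a parametrized equational translation `τ(x, ȳ)`,
where the distinguished variable `x` is variable `0` and the parameters are bound by a
universal quantifier. -/
def solSet (A : AlgStr S) (τ : Set (Trm S × Trm S)) : Set A.α :=
  {a | ∀ (v : ℕ → A.α), ∀ e ∈ τ,
    Trm.eval A (Function.update v 0 a) e.1 = Trm.eval A (Function.update v 0 a) e.2}

/-- `τ` defines truth in `Mod* L`. -/
def DefinesTruth (Lo : Logic S) (τ : Set (Trm S × Trm S)) : Prop :=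
  ∀ (A : AlgStr S) (F : Set A.α), IsDedFilter Lo A F → IsReducedMatrix A F →
    solSet A τ = F

/-- `τ` almost defines truth in `Mod* L` (i.e. on its non-almost-trivial members). -/
def AlmostDefinesTruth (Lo : Logic S) (τ : Set (Trm S × Trm S)) : Prop :=
  ∀ (A : AlgStr S) (F : Set A.α), IsDedFilter Lo A F → IsReducedMatrix A F →
    F.Nonempty → solSet A τ = F

/-- Only the distinguished variable `x` (variable `0`) occurs: no parameters. -/
def Trm.noParams : Trm S → Prop
  | .var n => n = 0
  | .app _ t => ∀ i, Trm.noParams (t i)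

/-- An equational translation: a set of equations in the single variable `x`. -/
def IsEqTranslation (τ : Set (Trm S × Trm S)) : Prop :=
  ∀ e ∈ τ, Trm.noParams e.1 ∧ Trm.noParams e.2

/-- The quotient of an algebra by a relation (intended: by a congruence). -/
noncomputable def quotAlg (A : AlgStr S) (r : A.α → A.α → Prop) : AlgStr S :=
  ⟨Quot r, fun f x => Quot.mk r (A.op f fun i => (x i).out)⟩
variable {S : AlgSig.{u}}

/-- Homomorphisms between algebras of the same signature. -/
structure AlgHomS (A B : AlgStr S) where
  toFun : A.α → B.α
  map_op : ∀ (f : S.F) (x : Fin (S.ar f) → A.α),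
    toFun (A.op f x) = B.op f fun i => toFun (x i)

/-- The Leibniz operator is completely order-reflecting on a family `X` of subsets. -/
def ComplOrderReflOn (A : AlgStr S) (X : Set (Set A.α)) : Prop :=
  ∀ (Fam : Set (Set A.α)) (G : Set A.α), Fam ⊆ X → G ∈ X →
    (∀ a b, (∀ F ∈ Fam, Leibniz A F a b) → Leibniz A G a b) → ⋂₀ Fam ⊆ G

/-- A Fregean logic: every Frege relation `Λ_L Γ` is a congruence of the term algebra. -/
def Fregean (Lo : Logic S) : Prop :=
  ∀ Γ : Set (Trm S),
    IsCong (TrmAlg S) fun φ ψ => ψ ∈ Lo.C (Γ ∪ {φ}) ∧ φ ∈ Lo.C (Γ ∪ {ψ})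

/-- A protoalgebraic logic: there is a set `Δ(x,y)` of formulas in two variables with
`∅ ⊢ Δ(x,x)` and `{x} ∪ Δ(x,y) ⊢ y`. -/
def Protoalgebraic (Lo : Logic S) : Prop :=
  ∃ Δ : Set (Trm S), (∀ d ∈ Δ, Trm.varsLT 2 d) ∧
    (∀ d ∈ Δ, Trm.subst (fun _ => Trm.var 0) d ∈ Lo.C ∅) ∧
    Trm.var 1 ∈ Lo.C ({Trm.var 0} ∪ Δ)

/-- The binary term `a ∧ b` built from a binary function symbol `m`. -/
def binT (m : S.F) (hm : S.ar m = 2) (a b : Trm S) : Trm S :=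
  Trm.app m fun i => ![a, b] (Fin.cast hm i)

/-- The binary operation of an algebra induced by a binary function symbol `m`. -/
def binA (A : AlgStr S) (m : S.F) (hm : S.ar m = 2) (a b : A.α) : A.α :=
  A.op m fun i => ![a, b] (Fin.cast hm i)

/-- A subuniverse (universe of a subalgebra). -/
def Subuniv (A : AlgStr S) (B : Set A.α) : Prop :=
  ∀ (f : S.F) (x : Fin (S.ar f) → A.α), (∀ i, x i ∈ B) → A.op f x ∈ B

/-- The subuniverse generated by a set. -/
def Sg (A : AlgStr S) (X : Set A.α) : Set A.α :=
  ⋂₀ {B | Subuniv A B ∧ X ⊆ B}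

/-- A subuniverse is `κ`-generated if it is generated by a subset of cardinality `≤ κ`. -/
def KGenerated (A : AlgStr S) (κ : Cardinal.{u}) (B : Set A.α) : Prop :=
  ∃ X : Set A.α, Cardinal.mk X ≤ κ ∧ Sg A X = B

/-- The subalgebra with universe a given subuniverse. -/
def subAlg (A : AlgStr S) (B : Set A.α) (hB : Subuniv A B) : AlgStr S :=
  ⟨B, fun f x => ⟨A.op f fun i => (x i).1, hB f _ fun i => (x i).2⟩⟩

/-- The signature expanded with a single new constant symbol `1`. -/
def expSig (S : AlgSig.{u}) : AlgSig.{u} :=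
  ⟨S.F ⊕ PUnit, Sum.elim S.ar fun _ => 0⟩

/-- The inclusion of the original terms into the terms of the expanded signature. -/
def Trm.incl : Trm S → Trm (expSig S)
  | .var n => .var n
  | .app f t => .app (Sum.inl f) fun i => Trm.incl (t i)
/-- For a homomorphism `f : A → B` and `F ⊆ B`:
(1) the preimage of `Ω^B F` under `f` is contained in `Ω^A f⁻¹[F]`, and
(2) if `f` is surjective then they coincide. -/
theorem leibniz_preimage {S : AlgSig.{u}} {A B : AlgStr S} (f : AlgHomS A B) (F : Set B.α) :
    (∀ a a' : A.α, Leibniz B F (f.toFun a) (f.toFun a') →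
      Leibniz A (f.toFun ⁻¹' F) a a') ∧
    (Function.Surjective f.toFun →
      ∀ a a' : A.α, Leibniz B F (f.toFun a) (f.toFun a') ↔
        Leibniz A (f.toFun ⁻¹' F) a a') := by
  have h1 : ∀ a a' : A.α, Leibniz B F (f.toFun a) (f.toFun a') →
      Leibniz A (f.toFun ⁻¹' F) a a' := by
    rintro a a' ⟨θ, ⟨he, hc⟩, hF, h⟩
    refine ⟨fun x y => θ (f.toFun x) (f.toFun y), ⟨⟨fun x => he.refl _, fun h => he.symm h,
      fun h h' => he.trans h h'⟩, ?_⟩, fun x y hxy hx => hF _ _ hxy hx, h⟩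
    intro g x y hxy
    simp only [f.map_op]
    exact hc g _ _ hxy
  refine ⟨h1, fun hs a a' => ⟨h1 a a', ?_⟩⟩
  rintro ⟨θ, ⟨he, hc⟩, hF, h⟩
  let R : B.α → B.α → Prop := fun b b' => ∃ x y, f.toFun x = b ∧ f.toFun y = b' ∧ θ x y
  refine ⟨Relation.EqvGen R, ⟨Relation.EqvGen.is_equivalence R, ?_⟩, ?_,
    Relation.EqvGen.rel _ _ ⟨a, a', rfl, rfl, h⟩⟩
  · intro g x y hxy
    have step : ∀ (z : Fin (S.ar g) → B.α) (i : Fin (S.ar g)) (b b' : B.α),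
        Relation.EqvGen R b b' →
        Relation.EqvGen R (B.op g (Function.update z i b)) (B.op g (Function.update z i b')) := by
      intro z i b b' hb
      induction hb with
      | refl => exact Relation.EqvGen.refl _
      | symm _ _ _ ih => exact Relation.EqvGen.symm _ _ ih
      | trans _ _ _ _ _ ih1 ih2 => exact Relation.EqvGen.trans _ _ _ ih1 ih2
      | rel b b' hr =>
        obtain ⟨u, v, rfl, rfl, huv⟩ := hr
        choose k hk using hs
        have key : ∀ u, f.toFun (A.op g (Function.update (fun j => k (z j)) i u)) =
            B.op g (Function.update z i (f.toFun u)) := by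
          intro u
          rw [f.map_op]
          congr 1
          funext j
          by_cases hj : j = i
          · subst hj; simp
          · simp [hj, hk]
        refine Relation.EqvGen.rel _ _ ⟨_, _, key u, key v, hc g _ _ ?_⟩
        intro j
        by_cases hj : j = i
        · subst hj; simpa using huv
        · simpa [hj] using he.refl _
    have main : ∀ s : Finset (Fin (S.ar g)),
        Relation.EqvGen R (B.op g x) (B.op g (s.piecewise y x)) := by
      intro s
      induction s using Finset.induction_on with
      | empty => simpa using Relation.EqvGen.refl _
      | insert i s hi ih =>
        refine Relation.EqvGen.trans _ _ _ ih ?_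
        have := step (s.piecewise y x) i (x i) (y i) (hxy i)
        rw [Finset.piecewise_insert]
        have e : Function.update (s.piecewise y x) i (x i) = s.piecewise y x := by
          rw [Function.update_eq_self_iff]
          simp [hi]
        rwa [e] at this
    simpa using main Finset.univ
  · have key : ∀ b b', Relation.EqvGen R b b' → (b ∈ F ↔ b' ∈ F) := by
      intro b b' hb
      induction hb with
      | refl => exact Iff.rfl
      | symm _ _ _ ih => exact ih.symm
      | trans _ _ _ _ _ ih1 ih2 => exact ih1.trans ih2
      | rel b b' hr =>
        obtain ⟨u, v, rfl, rfl, huv⟩ := hr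
        exact ⟨hF u v huv, hF v u (he.symm huv)⟩
    exact fun b b' hb => (key b b' hb).1
end

section
/- Let L be a logic, A an algebra, F ⊆ A, and a,b ∈ A. Then ⟨a,b⟩ belongs to the Suszko congruence Ω̃^A_L F if and only if for every unary polynomial function p of A, the deductive filter of L over A generated by F ∪ {p(a)} equals the deductive filter of L over A generated by F ∪ {p(b)}. -/
universe u

variable {S : AlgSig.{u}}

variable {S : AlgSig.{u}}

theorem suszkoAux_eval_subst {S : AlgSig.{u}} (A : AlgStr S) (v : ℕ → A.α) (σ : ℕ → Trm S)
    (t : Trm S) :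
    Trm.eval A v (Trm.subst σ t) = Trm.eval A (fun n => Trm.eval A v (σ n)) t := by
  induction t with
  | var n => rfl
  | app f t ih => simp only [Trm.subst, Trm.eval, ih]

theorem suszkoAux_poly_op {S : AlgSig.{u}} (A : AlgStr S) (p : A.α → A.α) (hp : IsUnaryPoly A p)
    (f : S.F) (x : Fin (S.ar f) → A.α) (i : Fin (S.ar f)) :
    IsUnaryPoly A (fun c => p (A.op f (Function.update x i c))) := by
  obtain ⟨φ, v, h⟩ := hp
  refine ⟨Trm.subst (fun n => if n = 0 then
      Trm.app f (fun j => if j = i then Trm.var 0 else Trm.var (j.1 + 1))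
      else Trm.var (n + S.ar f)) φ,
    fun n => if h : n - 1 < S.ar f then x ⟨n - 1, h⟩ else v (n - S.ar f), fun c => ?_⟩
  beta_reduce
  rw [h, suszkoAux_eval_subst]
  congr 1
  funext n
  by_cases hn : n = 0
  · subst hn
    simp only [Function.update_self, if_true, Trm.eval]
    congr 1
    funext j
    by_cases hj : j = i
    · subst hj
      simp [Trm.eval]
    · simp [hj, Trm.eval]
  · have h1 : ¬ (n + S.ar f - 1 < S.ar f) := by omega
    have h2 : n + S.ar f ≠ 0 := by omega
    simp [hn, Trm.eval, h1]

theorem suszkoAux_cong {S : AlgSig.{u}} (A : AlgStr S) (G : Set A.α) :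
    IsCong A (fun a b => ∀ p, IsUnaryPoly A p → (p a ∈ G ↔ p b ∈ G)) := by
  refine ⟨⟨fun a p _ => Iff.rfl, fun h p hp => (h p hp).symm,
    fun h1 h2 p hp => (h1 p hp).trans (h2 p hp)⟩, fun f x y hxy p hp => ?_⟩
  classical
  have key : ∀ s : Finset (Fin (S.ar f)),
      p (A.op f x) ∈ G ↔ p (A.op f (s.piecewise y x)) ∈ G := by
    intro s
    induction s using Finset.induction_on with
    | empty => simp
    | insert j s hj ih =>
      rw [ih, Finset.piecewise_insert]
      have := hxy j _ (suszkoAux_poly_op A p hp f (s.piecewise y x) j)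
      have e : Function.update (s.piecewise y x) j (x j) = s.piecewise y x := by
        rw [Function.update_eq_self_iff]
        simp [hj]
      simpa only [e] using this
  simpa using key Finset.univ

theorem suszkoAux_eval_cong {S : AlgSig.{u}} (A : AlgStr S) (θ : A.α → A.α → Prop)
    (hθ : IsCong A θ) (v w : ℕ → A.α) (h : ∀ n, θ (v n) (w n)) (t : Trm S) :
    θ (Trm.eval A v t) (Trm.eval A w t) := by
  induction t with
  | var n => exact h n
  | app f t ih => exact hθ.2 f _ _ ih

/-- `⟨a,b⟩` is in the Suszko congruence `Ω̃^A_L F` iff for every unary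
polynomial function `p` of `A`, the deductive filters generated by `F ∪ {p a}` and by
`F ∪ {p b}` coincide. -/
theorem suszko_iff_unaryPoly {S : AlgSig.{u}} (Lo : Logic S) (A : AlgStr S)
    (F : Set A.α) (a b : A.α) :
    Suszko Lo A F a b ↔
      ∀ p : A.α → A.α, IsUnaryPoly A p →
        FgFilter Lo A (F ∪ {p a}) = FgFilter Lo A (F ∪ {p b}) := by
  constructor
  · intro h p hp
    have key : ∀ G, IsDedFilter Lo A G → F ⊆ G → (p a ∈ G ↔ p b ∈ G) := by
      intro G hG hF
      obtain ⟨θ, hθ, hc, hab⟩ := h G hG hF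
      obtain ⟨φ, v, hv⟩ := hp
      have hpab : θ (p a) (p b) := by
        rw [hv, hv]
        apply suszkoAux_eval_cong A θ hθ
        intro n
        by_cases hn : n = 0
        · subst hn
          simpa using hab
        · simpa [hn] using hθ.1.refl _
      exact ⟨hc _ _ hpab, hc _ _ (hθ.1.symm hpab)⟩
    ext c
    simp only [FgFilter, Set.mem_ofPred_eq, Set.union_subset_iff, Set.singleton_subset_iff]
    exact ⟨fun hh G hG hX => hh G hG ⟨hX.1, (key G hG hX.1).2 hX.2⟩,
      fun hh G hG hX => hh G hG ⟨hX.1, (key G hG hX.1).1 hX.2⟩⟩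
  · intro h G hG hF
    refine ⟨_, suszkoAux_cong A G, ?_, ?_⟩
    · intro c d hcd hc
      exact (hcd (fun x => x) ⟨Trm.var 0, fun _ => a, fun x => by simp [Trm.eval]⟩).1 hc
    · intro p hp
      have e := h p hp
      constructor
      · intro hpa
        have : p b ∈ FgFilter Lo A (F ∪ {p a}) := by
          rw [e]
          exact fun G' _ hX => hX (Or.inr rfl)
        exact this G hG (Set.union_subset hF (Set.singleton_subset_iff.2 hpa))
      · intro hpb
        have : p a ∈ FgFilter Lo A (F ∪ {p b}) := by
          rw [← e]
          exact fun G' _ hX => hX (Or.inr rfl)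
        exact this G hG (Set.union_subset hF (Set.singleton_subset_iff.2 hpb))
end

section
/- Let τ(x,ȳ) be a parametrized equational translation and ⟨A,F⟩ a matrix with F ≠ ∅. Then τ defines truth in the reduction ⟨A/Ω^A F, F/Ω^A F⟩ if and only if for every a ∈ A: a ∈ F ⟺ for every tuple c̄ of elements of A and every equation ε ≈ δ in τ, ⟨ε^A(a,c̄), δ^A(a,c̄)⟩ ∈ Ω^A F. -/
universe u

variable {S : AlgSig.{u}}

variable {S : AlgSig.{u}}

theorem leibniz_aux_update (A : AlgStr S) (F : Set A.α) (f : S.F)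
    (x : Fin (S.ar f) → A.α) (j : Fin (S.ar f)) (a b : A.α)
    (h : Relation.TransGen (Leibniz A F) a b) :
    Relation.TransGen (Leibniz A F) (A.op f (Function.update x j a))
      (A.op f (Function.update x j b)) := by
  refine Relation.TransGen.lift (fun c => A.op f (Function.update x j c)) ?_ _ _ h
  rintro a b ⟨θ, hθ, hc, hab⟩
  refine ⟨θ, hθ, hc, hθ.2 f _ _ fun i => ?_⟩
  by_cases hi : i = j
  · subst hi; simpa using hab
  · simpa [Function.update_of_ne hi] using hθ.1.refl (x i)

theorem leibniz_aux_refl (A : AlgStr S) (F : Set A.α) (a : A.α) : Leibniz A F a a :=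
  ⟨Eq, ⟨eq_equivalence, fun f x y h => by rw [funext h]⟩,
    fun a b h ha => h ▸ ha, rfl⟩

theorem leibniz_aux_symm (A : AlgStr S) (F : Set A.α) (a b : A.α) (h : Leibniz A F a b) :
    Leibniz A F b a := by
  obtain ⟨θ, hθ, hc, hab⟩ := h
  exact ⟨θ, hθ, hc, hθ.1.symm hab⟩

theorem leibniz_aux_compat (A : AlgStr S) (F : Set A.α) : CompatWith (Leibniz A F) F := by
  rintro a b ⟨θ, hθ, hc, hab⟩ ha
  exact hc a b hab ha

theorem transGen_aux_cong (A : AlgStr S) (F : Set A.α) :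
    IsCong A (Relation.TransGen (Leibniz A F)) := by
  classical
  refine ⟨⟨fun a => .single (leibniz_aux_refl A F a), fun {a b} h => ?_,
    fun h1 h2 => h1.trans h2⟩, ?_⟩
  · induction h with
    | single h => exact .single (leibniz_aux_symm A F _ _ h)
    | tail _ h ih => exact .head (leibniz_aux_symm A F _ _ h) ih
  · intro f x y h
    have key : ∀ s : Finset (Fin (S.ar f)),
        Relation.TransGen (Leibniz A F) (A.op f x) (A.op f (s.piecewise y x)) := by
      intro s
      induction s using Finset.induction_on with
      | empty => simpa using Relation.TransGen.single (leibniz_aux_refl A F (A.op f x))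
      | insert j s hj ih =>
        refine ih.trans ?_
        rw [Finset.piecewise_insert]
        have := leibniz_aux_update A F f (s.piecewise y x) j (x j) (y j) (h j)
        have e : Function.update (s.piecewise y x) j (x j) = s.piecewise y x := by
          rw [Function.update_eq_self_iff]; simp [hj]
        rwa [e] at this
    simpa using key Finset.univ

theorem leibniz_aux_eq (A : AlgStr S) (F : Set A.α) :
    Relation.TransGen (Leibniz A F) = Leibniz A F := by
  funext a b
  refine propext ⟨fun h => ⟨_, transGen_aux_cong A F, ?_, h⟩, .single⟩
  intro a b h ha
  induction h with
  | single h => exact leibniz_aux_compat A F _ _ h ha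
  | tail _ h ih => exact leibniz_aux_compat A F _ _ h ih

theorem leibniz_aux_cong (A : AlgStr S) (F : Set A.α) : IsCong A (Leibniz A F) := by
  have := transGen_aux_cong A F
  rwa [leibniz_aux_eq] at this

theorem leibniz_aux_mk (A : AlgStr S) (F : Set A.α) (a b : A.α) :
    Quot.mk (Leibniz A F) a = Quot.mk (Leibniz A F) b ↔ Leibniz A F a b := by
  rw [Quot.eq, (leibniz_aux_cong A F).1.eqvGen_iff]

theorem eval_aux_quot (A : AlgStr S) (F : Set A.α) (v : ℕ → A.α) (t : Trm S) :
    Trm.eval (quotAlg A (Leibniz A F)) (fun n => Quot.mk _ (v n)) t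
      = Quot.mk (Leibniz A F) (Trm.eval A v t) := by
  induction t with
  | var n => rfl
  | app f t ih =>
    refine (leibniz_aux_mk A F _ _).2 ((leibniz_aux_cong A F).2 f _ _ fun i => ?_)
    rw [← leibniz_aux_mk, ← ih i]
    exact Quot.out_eq _

theorem solSet_aux (τ : Set (Trm S × Trm S)) (A : AlgStr S) (F : Set A.α) (a : A.α) :
    (Quot.mk (Leibniz A F) a ∈ solSet (quotAlg A (Leibniz A F)) τ) ↔
      ∀ (v : ℕ → A.α), ∀ e ∈ τ,
          Leibniz A F (Trm.eval A (Function.update v 0 a) e.1)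
            (Trm.eval A (Function.update v 0 a) e.2) := by
  have hu : ∀ v : ℕ → A.α,
      Function.update (β := fun _ => (quotAlg A (Leibniz A F)).α)
        (fun n => Quot.mk (Leibniz A F) (v n)) 0 (Quot.mk (Leibniz A F) a)
      = fun n => Quot.mk (Leibniz A F) (Function.update v 0 a n) := by
    intro v
    funext n
    by_cases hn : n = 0
    · subst hn; simp only [Function.update_self]; exact Function.update_self ..
    · simp only [Function.update_of_ne hn]; exact Function.update_of_ne hn ..
  constructor
  · intro h v e he
    have := h (fun n => Quot.mk _ (v n)) e he
    rw [hu, eval_aux_quot, eval_aux_quot] at this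
    exact (leibniz_aux_mk A F _ _).1 this
  · intro h w e he
    have hw : w = fun n => Quot.mk (Leibniz A F) (Quot.out (w n)) := by
      funext n; exact (Quot.out_eq _).symm
    rw [hw, hu, eval_aux_quot, eval_aux_quot]
    exact (leibniz_aux_mk A F _ _).2 (h _ e he)

theorem mem_image_aux (A : AlgStr S) (F : Set A.α) (a : A.α) :
    Quot.mk (Leibniz A F) a ∈ Quot.mk (Leibniz A F) '' F ↔ a ∈ F := by
  constructor
  · rintro ⟨b, hb, h⟩
    exact leibniz_aux_compat A F b a ((leibniz_aux_mk A F _ _).1 h) hb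
  · exact fun h => ⟨a, h, rfl⟩

/-- a parametrized equational translation `τ` defines truth in the
reduction `⟨A/Ω^A F, F/Ω^A F⟩` of a non-almost-trivial matrix `⟨A,F⟩` iff for every
`a ∈ A`: `a ∈ F` ⟺ all equations of `τ` at `a` (with arbitrary parameters) hold
modulo `Ω^A F`. -/
theorem definesTruth_reduction_iff {S : AlgSig.{u}} (τ : Set (Trm S × Trm S))
    (A : AlgStr S) (F : Set A.α) (hF : F.Nonempty) :
    solSet (quotAlg A (Leibniz A F)) τ = Quot.mk (Leibniz A F) '' F ↔
      ∀ a : A.α, a ∈ F ↔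
        ∀ (v : ℕ → A.α), ∀ e ∈ τ,
          Leibniz A F (Trm.eval A (Function.update v 0 a) e.1)
            (Trm.eval A (Function.update v 0 a) e.2) := by
  constructor
  · intro h a
    rw [← solSet_aux, h]
    exact (mem_image_aux A F a).symm
  · intro h
    ext q
    obtain ⟨a, rfl⟩ := Quot.exists_rep q
    exact (solSet_aux τ A F a).trans ((h a).symm.trans (mem_image_aux A F a).symm)
end

section
/- For every logic L and every substitution σ : Fm → Fm, if ⟨φ,ψ⟩ belongs to the Suszko congruence Ω̃_L C_L{x} (over the term algebra Fm), then ⟨σφ, σψ⟩ belongs to Ω̃_L C_L{σx}; that is, σ[Ω̃_L C_L{x}] ⊆ Ω̃_L C_L{σx}. -/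
universe u

variable {S : AlgSig.{u}}

variable {S : AlgSig.{u}}

theorem aux_varsLT_mono {S : AlgSig.{u}} {m n : ℕ} (hmn : m ≤ n) (t : Trm S)
    (h : Trm.varsLT m t) : Trm.varsLT n t := by
  induction t with
  | var k => exact lt_of_lt_of_le h hmn
  | app f t ih => exact fun i => ih i (h i)

theorem aux_varsLT_exists {S : AlgSig.{u}} (t : Trm S) : ∃ n, Trm.varsLT n t := by
  induction t with
  | var k => exact ⟨k + 1, Nat.lt_succ_self k⟩
  | app f t ih =>
    choose N hN using ih
    exact ⟨Finset.univ.sup N, fun i =>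
      aux_varsLT_mono (Finset.le_sup (f := N) (Finset.mem_univ i)) _ (hN i)⟩

theorem aux_subst_congr {S : AlgSig.{u}} {n : ℕ} (σ τ : ℕ → Trm S)
    (hst : ∀ k, k < n → σ k = τ k) (t : Trm S) (h : Trm.varsLT n t) :
    Trm.subst σ t = Trm.subst τ t := by
  induction t with
  | var k => exact hst k h
  | app f t ih =>
    simp only [Trm.subst]
    congr 1
    funext i
    exact ih i (h i)

theorem aux_eval_subst {S : AlgSig.{u}} (τ v : ℕ → Trm S) (t : Trm S) :
    Trm.subst τ (Trm.eval (TrmAlg S) v t) =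
      Trm.eval (TrmAlg S) (fun k => Trm.subst τ (v k)) t := by
  induction t with
  | var k => rfl
  | app f t ih =>
    change Trm.app f (fun i => Trm.subst τ (Trm.eval (TrmAlg S) v (t i))) =
      Trm.app f (fun i => Trm.eval (TrmAlg S) (fun k => Trm.subst τ (v k)) (t i))
    congr 1
    funext i
    exact ih i

theorem aux_surj {S : AlgSig.{u}} (τ : ℕ → Trm S) (h : ∀ k, ∃ m, τ m = Trm.var k)
    (t : Trm S) : ∃ s, Trm.subst τ s = t := by
  induction t with
  | var k => obtain ⟨m, hm⟩ := h k; exact ⟨.var m, hm⟩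
  | app f t ih =>
    choose s hs using ih
    exact ⟨.app f s, by simp only [Trm.subst, hs]⟩

theorem aux_leibniz {S : AlgSig.{u}} (τ : ℕ → Trm S)
    (hs : ∀ t : Trm S, ∃ s, Trm.subst τ s = t) (G : Set (Trm S)) (a b : Trm S)
    (h : Leibniz (TrmAlg S) (Trm.subst τ ⁻¹' G) a b) :
    Leibniz (TrmAlg S) G (Trm.subst τ a) (Trm.subst τ b) := by
  classical
  obtain ⟨θ, ⟨he, hc⟩, hcomp, hab⟩ := h
  let B : Trm S → Trm S → Prop := fun x y =>
    ∃ c d, θ c d ∧ Trm.subst τ c = x ∧ Trm.subst τ d = y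
  have hone : ∀ (f : S.F) (z : Fin (S.ar f) → Trm S) (i : Fin (S.ar f)) (x y : Trm S),
      Relation.EqvGen B x y →
      Relation.EqvGen B (Trm.app f (Function.update z i x))
        (Trm.app f (Function.update z i y)) := by
    intro f z i x y hxy
    induction hxy with
    | rel x y h =>
      obtain ⟨c, d, hcd, rfl, rfl⟩ := h
      choose s hs' using fun j => hs (z j)
      have key : ∀ e, Trm.subst τ (Trm.app f (Function.update s i e)) =
          Trm.app f (Function.update z i (Trm.subst τ e)) := by
        intro e
        simp only [Trm.subst]
        congr 1
        funext j
        by_cases hj : j = i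
        · subst hj; simp
        · simp [hj, hs']
      refine .rel _ _ ⟨_, _, hc f (Function.update s i c) (Function.update s i d) ?_,
        key c, key d⟩
      intro j
      have hu : ∀ e : Trm S, (j = i → Function.update s i e j = e) ∧
          (j ≠ i → Function.update s i e j = s j) := by
        intro e
        exact ⟨fun hj => by subst hj; simp, fun hj => by simp [hj]⟩
      by_cases hj : j = i
      · have e1 := (hu c).1 hj
        have e2 := (hu d).1 hj
        exact e1.symm ▸ e2.symm ▸ hcd
      · have e1 := (hu c).2 hj
        have e2 := (hu d).2 hj
        exact e1.symm ▸ e2.symm ▸ he.refl (s j)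
    | refl x => exact .refl _
    | symm x y _ ih => exact .symm _ _ ih
    | trans x y w _ _ ih1 ih2 => exact .trans _ _ _ ih1 ih2
  refine ⟨Relation.EqvGen B, ⟨Relation.EqvGen.is_equivalence B, ?_⟩, ?_,
    .rel _ _ ⟨a, b, hab, rfl, rfl⟩⟩
  · intro f (x : Fin (S.ar f) → Trm S) (y : Fin (S.ar f) → Trm S) hxy
    have hp : ∀ s : Finset (Fin (S.ar f)),
        Relation.EqvGen B (Trm.app f x) (Trm.app f (s.piecewise y x)) := by
      intro s
      induction s using Finset.induction_on with
      | empty => simpa using Relation.EqvGen.refl (r := B) (Trm.app f x)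
      | insert j s hj ih =>
        refine .trans _ _ _ ih ?_
        rw [Finset.piecewise_insert]
        have := hone f (s.piecewise y x) j (x j) (y j) (hxy j)
        have e : Function.update (s.piecewise y x) j (x j) = s.piecewise y x := by
          rw [Function.update_eq_self_iff]
          simp [hj]
        rwa [e] at this
    have hfin := hp Finset.univ
    rw [Finset.piecewise_univ] at hfin
    exact hfin
  · have : ∀ x y, Relation.EqvGen B x y → (x ∈ G ↔ y ∈ G) := by
      intro x y hxy
      induction hxy with
      | rel x y h =>
        obtain ⟨c, d, hcd, rfl, rfl⟩ := h
        exact ⟨hcomp c d hcd, hcomp d c (he.symm hcd)⟩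
      | refl x => exact Iff.rfl
      | symm x y _ ih => exact ih.symm
      | trans x y w _ _ ih1 ih2 => exact ih1.trans ih2
    exact fun x y hxy => (this x y hxy).1

/-- `σ[Ω̃_L C_L{x}] ⊆ Ω̃_L C_L{σx}` for every substitution `σ`. -/
theorem suszko_subst {S : AlgSig.{u}} (Lo : Logic S) (σ : ℕ → Trm S) (φ ψ : Trm S)
    (h : Suszko Lo (TrmAlg S) (Lo.C {Trm.var 0}) φ ψ) :
    Suszko Lo (TrmAlg S) (Lo.C {Trm.subst σ (Trm.var 0)})
      (Trm.subst σ φ) (Trm.subst σ ψ) := by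
  intro G hG hsub
  obtain ⟨n1, h1⟩ := aux_varsLT_exists φ
  obtain ⟨n2, h2⟩ := aux_varsLT_exists ψ
  let N := n1 + n2 + 1
  let τ : ℕ → Trm S := fun k => if k < N then σ k else Trm.var (k - N)
  have hτ : ∀ k, k < N → σ k = τ k := fun k hk => by simp [τ, hk]
  have hs := aux_surj τ (fun k => ⟨k + N, by simp [τ]⟩)
  rw [aux_subst_congr σ τ hτ φ (aux_varsLT_mono (by omega) _ h1),
    aux_subst_congr σ τ hτ ψ (aux_varsLT_mono (by omega) _ h2)]
  apply aux_leibniz τ hs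
  apply h
  · intro Γ χ hχ v hv
    have hk := hG Γ χ hχ (fun k => Trm.subst τ (v k)) fun γ hγ =>
      (aux_eval_subst τ v γ) ▸ hv γ hγ
    rw [← aux_eval_subst τ v χ] at hk
    exact hk
  · intro χ hχ
    apply hsub
    have := Lo.structural τ {Trm.var 0} ⟨χ, hχ, rfl⟩
    rw [Set.image_singleton] at this
    have e : Trm.subst σ (Trm.var 0) = Trm.subst τ (Trm.var 0) := hτ 0 (by omega)
    rwa [e]
end

section
/- For every logic L, the following are equivalent: (i) truth is equationally definable in Mod* L; (ii) truth is parametrically equationally definable in Mod* L; (iii) truth is almost parametrically equationally definable in Mod* L and L has at least one theorem. In particular, if truth is equationally definable in Mod* L then L has theorems. -/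
universe u

variable {S : AlgSig.{u}}

variable {S : AlgSig.{u}}

inductive UPoly (A : AlgStr S) : (A.α → A.α) → Prop
  | id : UPoly A (fun a => a)
  | comp (p : A.α → A.α) (f : S.F) (x : Fin (S.ar f) → A.α) (i : Fin (S.ar f)) :
      UPoly A p → UPoly A (fun a => p (A.op f (Function.update x i a)))

def PRel (A : AlgStr S) (F : Set A.α) (a b : A.α) : Prop :=
  ∀ p, UPoly A p → (p a ∈ F ↔ p b ∈ F)

theorem PRel_cong (A : AlgStr S) (F : Set A.α) : IsCong A (PRel A F) := by
  have he : Equivalence (PRel A F) :=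
    ⟨fun _ _ _ => Iff.rfl, fun h p hp => (h p hp).symm,
      fun h k p hp => (h p hp).trans (k p hp)⟩
  refine ⟨he, fun f x y h => ?_⟩
  classical
  have key : ∀ s : Finset (Fin (S.ar f)), PRel A F (A.op f x) (A.op f (s.piecewise y x)) := by
    intro s
    induction s using Finset.induction_on with
    | empty => simpa using he.refl _
    | insert j s hj ih =>
      refine he.trans ih ?_
      intro p hp
      have h1 := h j _ (UPoly.comp p f (s.piecewise y x) j hp)
      have h2 : Function.update (s.piecewise y x) j (x j) = s.piecewise y x := by
        conv_rhs => rw [← Function.update_eq_self j (s.piecewise y x)]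
        rw [Finset.piecewise_eq_of_notMem _ _ _ hj]
      rw [Finset.piecewise_insert]
      simpa only [h2] using h1
  simpa using key Finset.univ

theorem PRel_compat (A : AlgStr S) (F : Set A.α) : CompatWith (PRel A F) F :=
  fun _ _ h ha => (h _ UPoly.id).1 ha

theorem cong_le_PRel (A : AlgStr S) (F : Set A.α) (θ : A.α → A.α → Prop)
    (hθ : IsCong A θ) (hc : CompatWith θ F) (a b : A.α) (h : θ a b) : PRel A F a b := by
  intro p hp
  induction hp generalizing a b with
  | id => exact ⟨hc _ _ h, hc _ _ (hθ.1.symm h)⟩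
  | comp p f x i hp ih =>
    apply ih
    apply hθ.2
    intro j
    by_cases hj : j = i
    · subst hj; simpa using h
    · simpa [hj] using hθ.1.refl _

theorem eval_quot (A : AlgStr S) (r : A.α → A.α → Prop) (hr : IsCong A r)
    (w : ℕ → A.α) (t : Trm S) :
    Trm.eval (quotAlg A r) (fun n => Quot.mk r (w n)) t = Quot.mk r (Trm.eval A w t) := by
  induction t with
  | var n => rfl
  | app f t ih =>
    simp only [Trm.eval, quotAlg] at ih ⊢
    apply Quot.sound
    apply hr.2
    intro i
    rw [ih i]
    exact (hr.1.quot_mk_eq_iff _ _).1 (Quot.out_eq _)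

theorem eval_eval (A : AlgStr S) (v : ℕ → A.α) (σ : ℕ → Trm S) (t : Trm S) :
    Trm.eval A v (Trm.eval (TrmAlg S) σ t) = Trm.eval A (fun n => Trm.eval A v (σ n)) t := by
  induction t with
  | var n => rfl
  | app f t ih =>
    change A.op f (fun i => Trm.eval A v (Trm.eval (TrmAlg S) σ (t i))) = A.op f _
    congr 1
    funext i
    exact ih i

theorem noParams_eval (σ : ℕ → Trm S) (hσ : ∀ n, (σ n).noParams) (t : Trm S) :
    Trm.noParams (Trm.eval (TrmAlg S) σ t) := by
  induction t with
  | var n => exact hσ n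
  | app f t ih => exact fun i => ih i

/-- quotient matrix facts -/
theorem quot_filter (Lo : Logic S) (A : AlgStr S) (F : Set A.α) (hF : IsDedFilter Lo A F) :
    ∃ G : Set (quotAlg A (PRel A F)).α, IsDedFilter Lo _ G ∧ IsReducedMatrix _ G ∧
      ∀ a, Quot.mk _ a ∈ G ↔ a ∈ F := by
  have hr := PRel_cong A F
  have hm : ∀ a, PRel A F ((Quot.mk (PRel A F) a).out) a := fun a =>
    (hr.1.quot_mk_eq_iff _ _).1 (Quot.out_eq _)
  let G : Set (quotAlg A (PRel A F)).α := {q | Quot.out q ∈ F}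
  have hG : ∀ a, (Quot.mk (PRel A F) a : (quotAlg A (PRel A F)).α) ∈ G ↔ a ∈ F := fun a =>
    ⟨PRel_compat A F _ _ (hm a), PRel_compat A F _ _ (hr.1.symm (hm a))⟩
  refine ⟨G, ?_, ?_, hG⟩
  · intro Γ φ h v hv
    have hvw : v = fun n => Quot.mk (PRel A F) (Quot.out (v n)) := by
      funext n; exact (Quot.out_eq _).symm
    rw [hvw] at hv ⊢
    rw [eval_quot A _ hr]
    refine (hG _).2 (hF Γ φ h _ ?_)
    intro γ hγ
    have := hv γ hγ
    rw [eval_quot A _ hr] at this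
    exact (hG _).1 this
  · intro a b
    constructor
    · rintro ⟨θ, hθ, hc, hab⟩
      revert hab
      refine Quot.inductionOn a fun a => ?_
      refine Quot.inductionOn b fun b => ?_
      intro hab
      apply Quot.sound
      refine cong_le_PRel A F (fun a b => θ (Quot.mk _ a) (Quot.mk _ b)) ?_ ?_ a b hab
      · refine ⟨⟨fun _ => hθ.1.refl _, fun h => hθ.1.symm h, fun h k => hθ.1.trans h k⟩, ?_⟩
        intro f x y h
        have h1 := hθ.2 f _ _ h
        have h2 : ∀ x : Fin (S.ar f) → A.α,
            (quotAlg A (PRel A F)).op f (fun i => Quot.mk _ (x i)) = Quot.mk _ (A.op f x) :=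
          fun x => Quot.sound (hr.2 _ _ _ fun i => hm _)
        rw [h2, h2] at h1
        exact h1
      · intro a b h ha
        exact (hG b).1 (hc _ _ h ((hG a).2 ha))
    · rintro rfl
      refine ⟨Eq, ⟨eq_equivalence, fun f x y h => by rw [funext h]⟩, ?_, rfl⟩
      rintro a _ rfl h
      exact h

theorem nonempty_of_defines (Lo : Logic S) (τ : Set (Trm S × Trm S)) (h : DefinesTruth Lo τ) :
    (Lo.C ∅).Nonempty := by
  by_contra hn
  rw [Set.not_nonempty_iff_eq_empty] at hn
  let A : AlgStr S := ⟨PUnit, fun _ _ => PUnit.unit⟩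
  have h1 := h A ∅ ?_ ?_
  · have : (PUnit.unit : A.α) ∈ solSet A τ := fun v e _ => rfl
    rw [h1] at this
    exact this
  · intro Γ φ hφ v hv
    have : Γ = ∅ := Set.eq_empty_of_forall_notMem fun γ hγ => hv γ hγ
    rw [this, hn] at hφ
    exact hφ.elim
  · intro a b
    exact ⟨fun _ => rfl, fun _ => ⟨Eq, ⟨eq_equivalence, fun f x y h => rfl⟩,
      fun _ _ _ h => h.elim, rfl⟩⟩

def unparam (τ : Set (Trm S × Trm S)) : Set (Trm S × Trm S) :=
  {d | ∃ e ∈ τ, ∃ σ : ℕ → Trm S, σ 0 = Trm.var 0 ∧ (∀ n, (σ n).noParams) ∧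
    d = (Trm.eval (TrmAlg S) σ e.1, Trm.eval (TrmAlg S) σ e.2)}

theorem unparam_defines (Lo : Logic S) (τ : Set (Trm S × Trm S)) (h : DefinesTruth Lo τ) :
    DefinesTruth Lo (unparam τ) := by
  intro A F hF hR
  ext a
  constructor
  · intro ha
    let c : ℕ → A.α := fun _ => a
    let T : Set (TrmAlg S).α := {t | Trm.eval A c t ∈ F}
    have hT : IsDedFilter Lo (TrmAlg S) T := by
      intro Γ φ hφ v hv
      change Trm.eval A c (Trm.eval (TrmAlg S) v φ) ∈ F
      refine (eval_eval A c v φ).symm ▸ hF Γ φ hφ _ fun γ hγ => ?_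
      exact (eval_eval A c v γ) ▸ hv γ hγ
    obtain ⟨G, hG, hGr, hGm⟩ := quot_filter Lo _ T hT
    have hsol := h _ G hG hGr
    have hx : (Quot.mk _ (Trm.var 0 : Trm S) : (quotAlg (TrmAlg S) (PRel (TrmAlg S) T)).α) ∈
        solSet (quotAlg (TrmAlg S) (PRel (TrmAlg S) T)) τ := by
      intro v e he
      let σ : ℕ → (TrmAlg S).α := Function.update (fun n => Quot.out (v n)) 0 (Trm.var 0 : Trm S)
      have hv : Function.update v 0 (Quot.mk _ (Trm.var 0 : Trm S)) =
          fun n => Quot.mk (PRel (TrmAlg S) T) (σ n) := by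
        funext n
        by_cases hn : n = 0
        · subst hn; rfl
        · have e1 : σ n = Quot.out (v n) := Function.update_of_ne hn _ _
          rw [e1]
          exact (Function.update_of_ne hn _ _).trans (Quot.out_eq (v n)).symm
      rw [hv, eval_quot _ _ (PRel_cong _ _), eval_quot _ _ (PRel_cong _ _)]
      apply Quot.sound
      refine cong_le_PRel _ T (fun s t => Trm.eval A c s = Trm.eval A c t) ?_ ?_ _ _ ?_
      · refine ⟨⟨fun _ => rfl, fun h => h.symm, fun h k => h.trans k⟩, fun f x y h => ?_⟩
        change A.op f _ = A.op f _
        rw [funext h]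
      · intro s t hst hs
        change Trm.eval A c t ∈ F
        rw [← hst]; exact hs
      · let ρ : ℕ → Trm S := fun n => Trm.eval (TrmAlg S) (fun _ => (Trm.var 0 : Trm S)) (σ n)
        have h1 := ha c (Trm.eval (TrmAlg S) ρ e.1, Trm.eval (TrmAlg S) ρ e.2)
          ⟨e, he, ρ, rfl, fun n => noParams_eval (fun _ => Trm.var 0) (fun _ => rfl) _, rfl⟩
        have hc : Function.update c 0 a = c := Function.update_eq_self 0 c
        rw [hc] at h1
        have h2 : (fun n => Trm.eval A c (ρ n)) = fun n => Trm.eval A c (σ n) := by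
          funext n
          exact eval_eval A c _ (σ n)
        have h3 := ((eval_eval A c ρ e.1).symm.trans h1).trans (eval_eval A c ρ e.2)
        rw [h2] at h3
        exact ((eval_eval A c σ e.1).trans h3).trans (eval_eval A c σ e.2).symm
    rw [hsol] at hx
    exact (hGm _).1 hx
  · intro ha v d hd
    obtain ⟨e, he, σ, h0, -, rfl⟩ := hd
    rw [← h A F hF hR] at ha
    refine (eval_eval A _ σ e.1).trans (Eq.trans ?_ (eval_eval A _ σ e.2).symm)
    have h1 := ha (fun n => Trm.eval A (Function.update v 0 a) (σ n)) e he
    rwa [Function.update_eq_self_iff.2 (by rw [h0]; simp [Trm.eval])] at h1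

theorem eqDefinable_iff_paramEqDefinable {S : AlgSig.{u}} (Lo : Logic S) :
    ((∃ τ : Set (Trm S × Trm S), IsEqTranslation τ ∧ DefinesTruth Lo τ) ↔
      (∃ τ : Set (Trm S × Trm S), DefinesTruth Lo τ)) ∧
    ((∃ τ : Set (Trm S × Trm S), DefinesTruth Lo τ) ↔
      ((∃ τ : Set (Trm S × Trm S), AlmostDefinesTruth Lo τ) ∧ (Lo.C ∅).Nonempty)) ∧
    ((∃ τ : Set (Trm S × Trm S), IsEqTranslation τ ∧ DefinesTruth Lo τ) →
      (Lo.C ∅).Nonempty) := by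
  refine ⟨⟨fun ⟨τ, _, h⟩ => ⟨τ, h⟩, fun ⟨τ, h⟩ => ⟨unparam τ, ?_, unparam_defines Lo τ h⟩⟩,
    ⟨fun ⟨τ, h⟩ => ⟨⟨τ, fun A F hF hR _ => h A F hF hR⟩, nonempty_of_defines Lo τ h⟩, ?_⟩,
    fun ⟨τ, _, h⟩ => nonempty_of_defines Lo τ h⟩
  · rintro d ⟨e, _, σ, _, hσ, rfl⟩
    exact ⟨noParams_eval σ hσ _, noParams_eval σ hσ _⟩
  · rintro ⟨⟨τ, h⟩, φ, hφ⟩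
    refine ⟨τ, fun A F hF hR => ?_⟩
    rcases isEmpty_or_nonempty A.α with hA | ⟨⟨a⟩⟩
    · ext a; exact hA.elim a
    · exact h A F hF hR ⟨_, hF ∅ φ hφ (fun _ => a) (by simp)⟩
end

section
/- Let K be a class of algebras whose type includes a binary operation ∧ interpreted in each member as a meet-semilattice operation, and let L be the logic determined by the class of matrices {⟨A,{1}⟩ : A ∈ K and A has a greatest element 1 with respect to the ∧-semilattice order}. Then truth is almost parametrically equationally definable in Mod* L; indeed the parametrized equational translation τ(x,y) := {x ∧ y ≈ y} almost defines truth in Mod* L. -/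
universe u

variable {S : AlgSig.{u}}

variable {S : AlgSig.{u}}

theorem eval_binT' {S : AlgSig.{u}} (A : AlgStr S) (m : S.F) (hm : S.ar m = 2) (v : ℕ → A.α)
    (s t : Trm S) :
    Trm.eval A v (binT m hm s t) = binA A m hm (Trm.eval A v s) (Trm.eval A v t) := by
  simp only [binT, binA, Trm.eval]
  congr 1
  funext i
  generalize Fin.cast hm i = j
  fin_cases j <;> rfl

theorem eval_agree {S : AlgSig.{u}} (A : AlgStr S) (n : ℕ) (v w : ℕ → A.α)
    (h : ∀ k, k < n → v k = w k) (t : Trm S) (ht : Trm.varsLT n t) :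
    Trm.eval A v t = Trm.eval A w t := by
  induction t with
  | var k => exact h k ht
  | app f t ih =>
    simp only [Trm.eval]
    congr 1
    funext i
    exact ih i (ht i)

theorem varsLT_mono {S : AlgSig.{u}} {n k : ℕ} (h : n ≤ k) (t : Trm S) (ht : Trm.varsLT n t) :
    Trm.varsLT k t := by
  induction t with
  | var j => exact lt_of_lt_of_le ht h
  | app f t ih => exact fun i => ih i (ht i)

/-- Unary polynomial functions built from basic translations. -/
inductive Tr {S : AlgSig.{u}} (A : AlgStr S) : (A.α → A.α) → Prop
  | id : Tr A (fun x => x)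
  | step (g : A.α → A.α) (f : S.F) (c : Fin (S.ar f) → A.α) (i : Fin (S.ar f)) :
      Tr A g → Tr A (fun x => A.op f (Function.update c i (g x)))

theorem Tr.inner {S : AlgSig.{u}} {A : AlgStr S} {g : A.α → A.α} (hg : Tr A g)
    (f : S.F) (c : Fin (S.ar f) → A.α) (i : Fin (S.ar f)) :
    Tr A (fun x => g (A.op f (Function.update c i x))) := by
  induction hg with
  | id => exact Tr.step _ f c i Tr.id
  | step g f' c' i' _ ih => exact Tr.step _ f' c' i' ih

def trRel {S : AlgSig.{u}} (A : AlgStr S) (F : Set A.α) (p q : A.α) : Prop :=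
  ∀ g, Tr A g → (g p ∈ F ↔ g q ∈ F)

theorem trRel_cong {S : AlgSig.{u}} (A : AlgStr S) (F : Set A.α) : IsCong A (trRel A F) := by
  refine ⟨⟨fun _ _ _ => Iff.rfl, fun h g hg => (h g hg).symm,
    fun h h' g hg => (h g hg).trans (h' g hg)⟩, ?_⟩
  intro f x y hxy
  have key : ∀ s : Finset (Fin (S.ar f)), trRel A F (A.op f x) (A.op f (s.piecewise y x)) := by
    intro s
    induction s using Finset.induction_on with
    | empty => simp only [Finset.piecewise_empty]; exact fun _ _ => Iff.rfl
    | insert j s hj ih =>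
      intro g hg
      rw [ih g hg, Finset.piecewise_insert]
      have := hxy j _ (hg.inner f (s.piecewise y x) j)
      rw [← this]
      have e : Function.update (s.piecewise y x) j (x j) = s.piecewise y x := by
        rw [Function.update_eq_self_iff]
        simp [hj]
      rw [e]
  have := key Finset.univ
  simpa using this

theorem Tr.terms {S : AlgSig.{u}} (m : S.F) (hm : S.ar m = 2) (K : AlgStr S → Prop)
    (hK : ∀ A : AlgStr S, K A → ∀ a b : A.α, binA A m hm a b = binA A m hm b a)
    (A : AlgStr S) (a c : A.α) {g : A.α → A.α} (hg : Tr A g) :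
    ∃ (n : ℕ) (φ ψ : Trm S) (v : ℕ → A.α), 0 < n ∧ v 0 = a ∧ Trm.varsLT n φ ∧ Trm.varsLT n ψ ∧
      Trm.eval A v φ = g (binA A m hm a c) ∧ Trm.eval A v ψ = g c ∧
      ∀ B : AlgStr S, K B → ∀ one : B.α, (∀ b : B.α, binA B m hm b one = b) →
        ∀ w : ℕ → B.α, w 0 = one → Trm.eval B w φ = Trm.eval B w ψ := by
  induction hg with
  | id =>
    refine ⟨2, binT m hm (Trm.var 0) (Trm.var 1), Trm.var 1, fun k => if k = 0 then a else c,
      by norm_num, by simp, ?_, ?_, ?_, ?_, ?_⟩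
    · intro i
      show Trm.varsLT 2 (![Trm.var 0, Trm.var 1] (Fin.cast hm i))
      generalize Fin.cast hm i = j
      fin_cases j <;> simp [Trm.varsLT]
    · simp [Trm.varsLT]
    · rw [eval_binT']; simp [Trm.eval]
    · simp [Trm.eval]
    · intro B hB one h1 w hw
      rw [eval_binT']
      simp only [Trm.eval]
      rw [hw, hK B hB, h1]
  | step g f d i _ ih =>
    obtain ⟨n, φ, ψ, v, hn, hv, hφ, hψ, eφ, eψ, hB⟩ := ih
    let v' : ℕ → A.α := fun k => if k < n then v k else
      if h : k - n < S.ar f then d ⟨k - n, h⟩ else a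
    have agree : ∀ k, k < n → v' k = v k := fun k hk => by simp [v', hk]
    have ev : ∀ (χ : Trm S) (z : A.α), Trm.varsLT n χ → Trm.eval A v χ = z →
        Trm.eval A v' (Trm.app f fun j => if j = i then χ else Trm.var (n + j)) =
          A.op f (Function.update d i z) := by
      intro χ z hχ hz
      simp only [Trm.eval]
      congr 1
      funext j
      by_cases hj : j = i
      · subst hj
        simp [eval_agree A n v' v agree χ hχ, hz]
      · simp [hj, Trm.eval, v']
    have vl : ∀ χ : Trm S, Trm.varsLT n χ → Trm.varsLT (n + S.ar f)
        (Trm.app f fun j => if j = i then χ else Trm.var (n + j)) := by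
      intro χ hχ j
      show Trm.varsLT (n + S.ar f) (if j = i then χ else Trm.var (n + j))
      split_ifs
      · exact varsLT_mono (by omega) χ hχ
      · simp [Trm.varsLT]
    refine ⟨n + S.ar f, _, _, v', by omega, by rw [agree 0 hn, hv], vl φ hφ, vl ψ hψ,
      ev φ _ hφ eφ, ev ψ _ hψ eψ, ?_⟩
    intro B hKB one h1 w hw
    simp only [Trm.eval]
    congr 1
    funext j
    split_ifs
    · exact hB B hKB one h1 w hw
    · rfl

/-- if `K` is a class of algebras whose type includes a binary
meet-semilattice operation `∧`, and `L` is the logic determined by the matrices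
`⟨A, {1}⟩` for `A ∈ K` with greatest element `1` in the semilattice order, then
`τ(x,y) := {x ∧ y ≈ y}` almost defines truth in `Mod* L`. -/
theorem semilattice_almostParamEqDefinable {S : AlgSig.{u}} (m : S.F) (hm : S.ar m = 2)
    (K : AlgStr S → Prop)
    (hK : ∀ A : AlgStr S, K A →
      (∀ a b : A.α, binA A m hm a b = binA A m hm b a) ∧
      (∀ a b c : A.α, binA A m hm (binA A m hm a b) c = binA A m hm a (binA A m hm b c)) ∧
      (∀ a : A.α, binA A m hm a a = a))
    (Lo : Logic S)
    (hLo : ∀ (Γ : Set (Trm S)) (φ : Trm S), φ ∈ Lo.C Γ ↔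
      ∀ A : AlgStr S, K A → ∀ one : A.α, (∀ a : A.α, binA A m hm a one = a) →
        ∀ v : ℕ → A.α, (∀ γ ∈ Γ, Trm.eval A v γ = one) → Trm.eval A v φ = one) :
    AlmostDefinesTruth Lo {(binT m hm (Trm.var 0) (Trm.var 1), Trm.var 1)} := by
  intro A F hF hR hne
  have hcomm := fun B hB => (hK B hB).1
  ext a
  constructor
  · intro ha
    obtain ⟨y, hy⟩ := hne
    have h1 := ha (fun _ => y) _ rfl
    simp only [eval_binT'] at h1
    have h2 := hF {binT m hm (Trm.var 0) (Trm.var 1)} (Trm.var 0) (by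
      rw [hLo]
      intro B hB one h1 v hv
      have := hv _ rfl
      rw [eval_binT'] at this
      obtain ⟨-, ass, idm⟩ := hK B hB
      rw [← h1 (Trm.eval B v (Trm.var 0)), ← this, ← ass, idm]) (Function.update (fun _ => y) 0 a)
    simp only [Set.mem_singleton_iff, forall_eq, eval_binT', h1] at h2
    simpa [Trm.eval] using h2 (by simpa [Trm.eval] using hy)
  · intro ha v e he
    rw [Set.mem_singleton_iff] at he
    subst he
    simp only [eval_binT']
    simp only [Trm.eval, Function.update_self]
    rw [← hR]
    generalize Function.update v 0 a 1 = c
    refine ⟨trRel A F, trRel_cong A F, fun p q h hp => (h _ Tr.id).1 hp, ?_⟩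
    intro g hg
    obtain ⟨n, φ, ψ, v, -, hv, -, -, eφ, eψ, hB⟩ := hg.terms m hm K hcomm A a c
    rw [← eφ, ← eψ]
    constructor
    · intro h
      refine hF {Trm.var 0, φ} ψ ?_ v ?_
      · rw [hLo]
        intro B hKB one h1 w hw
        rw [← hB B hKB one h1 w (hw (Trm.var 0) (by simp))]
        exact hw φ (by simp)
      · rintro γ (rfl | rfl)
        · simpa [Trm.eval, hv] using ha
        · exact h
    · intro h
      refine hF {Trm.var 0, ψ} φ ?_ v ?_
      · rw [hLo]
        intro B hKB one h1 w hw
        rw [hB B hKB one h1 w (hw (Trm.var 0) (by simp))]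
        exact hw ψ (by simp)
      · rintro γ (rfl | rfl)
        · simpa [Trm.eval, hv] using ha
        · exact h
end
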